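/- For 𝔰 = 2 and every real p with 0 < p < 1, the relative second moment of the alive-particle-filter estimator satisfies E_rel(2, p) = −log p/(1 − p). -/

import Mathlib

/-- The probability mass function of `X = M - 1`, where `M` is the number of i.i.d.
Bernoulli(`p`) trials needed to obtain `𝔰` successes (a shifted negative binomial):
`f_{𝔰,p}(x) = (x! / ((𝔰−1)!·(x+1−𝔰)!))·p^𝔰·(1−p)^{x+1−𝔰}` for integers `x ≥ 𝔰 − 1`. -/
noncomputable def nbPMF (𝔰 : ℕ) (p : ℝ) (x : ℕ) : ℝ :=
  (Nat.factorial x : ℝ) /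
      ((Nat.factorial (𝔰 - 1) : ℝ) * (Nat.factorial (x + 1 - 𝔰) : ℝ)) *
    p ^ 𝔰 * (1 - p) ^ (x + 1 - 𝔰)

/-- The relative second moment `E_rel(𝔰, p) = E[P²]/p²` of the alive-particle-filter
estimator `P = (𝔰−1)/(M−1)`, i.e. `((𝔰−1)²/p²)·∑_{x ≥ 𝔰−1} f_{𝔰,p}(x)/x²`. -/
noncomputable def Erel (𝔰 : ℕ) (p : ℝ) : ℝ :=
  ((𝔰 : ℝ) - 1) ^ 2 / p ^ 2 *
    ∑' x : ℕ, if 𝔰 - 1 ≤ x then nbPMF 𝔰 p x / (x : ℝ) ^ 2 else 0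

/-- **Proposition 2, case `𝔰 = 2`**: for every `0 < p < 1`,
`E_rel(2, p) = −log p/(1 − p)`. -/
theorem Erel_two (p : ℝ) (hp0 : 0 < p) (hp1 : p < 1) :
    Erel 2 p = -Real.log p / (1 - p) := by
  have hq : 1 - p ≠ 0 := by linarith
  have hlog := (Real.hasSum_pow_div_log_of_abs_lt_one (x := 1 - p)
    (by rw [abs_of_pos (by linarith)]; linarith)).mul_left (p ^ 2 / (1 - p))
  have hsum : HasSum
      (fun x : ℕ => if 2 - 1 ≤ x then nbPMF 2 p x / (x : ℝ) ^ 2 else 0)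
      (p ^ 2 / (1 - p) * -Real.log (1 - (1 - p))) := by
    rw [← hasSum_nat_add_iff' 1]
    simp only [Finset.sum_range_one, nonpos_iff_eq_zero, Nat.add_one_sub_one, one_ne_zero,
      if_false, sub_zero]
    convert! hlog using 1
    funext n
    have hfact : (n.factorial : ℝ) ≠ 0 := by exact_mod_cast n.factorial_ne_zero
    have hn : (n : ℝ) + 1 ≠ 0 := by positivity
    rw [if_pos (Nat.le_add_left 1 n), nbPMF, show n + 1 + 1 - 2 = n by omega,
      Nat.factorial_succ]
    push_cast
    simp only [Nat.factorial_one]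
    field_simp
    ring
  rw [Erel, hsum.tsum_eq, sub_sub_cancel]
  push_cast
  field_simp
  ring
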